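/- arXiv:2208.11158 — 4 statements merged into one kernel-verified Lean document; each statement's English description precedes it below -/
import Mathlib

section
/- Sign-symmetry-adapted Putinar representation: let f, g₁,…,g_m ∈ ℝ[x₁,…,xₙ] and X = {x ∈ ℝⁿ : g₁(x) ≥ 0, …, g_m(x) ≥ 0}. Assume the quadratic module M(g) = {σ₀ + Σ_{j=1}^m σ_j·g_j : σ₀,…,σ_m sums of squares} is Archimedean, i.e. there exists N > 0 with N − (x₁² + ⋯ + xₙ²) ∈ M(g). Let A = supp(f) ∪ supp(g₁) ∪ ⋯ ∪ supp(g_m). If f(x) > 0 for all x ∈ X, then f = σ₀ + Σ_{j=1}^m σ_j·g_j for some sums of squares σ₀,…,σ_m such that for every j ∈ {0,1,…,m}, every α ∈ supp(σ_j) and every sign symmetry s of A, one has sᵀα ≡ 0 (mod 2). -/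
open MvPolynomial

/-- A polynomial is a sum of squares. -/
def IsSOS {n : ℕ} (q : MvPolynomial (Fin n) ℝ) : Prop :=
  ∃ (t : ℕ) (h : Fin t → MvPolynomial (Fin n) ℝ), q = ∑ i, h i ^ 2

/-- A quadratic module of a commutative ring. -/
structure IsQuadraticModule {A : Type*} [CommRing A] (M : Set A) : Prop where
  one_mem : 1 ∈ M
  add_mem : ∀ {p q : A}, p ∈ M → q ∈ M → p + q ∈ M
  sq_mul_mem : ∀ (a : A) {p : A}, p ∈ M → a ^ 2 * p ∈ M

/-- The quadratic module obtained from `M` by adjoining the element `a`. -/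
def adjoinElement {A : Type*} [CommRing A] (M : Set A) (a : A) : Set A :=
  {q | ∃ p ∈ M, ∃ s, IsSumSq s ∧ q = p + s * a}

/-- `p` lies between `-ε` and `ε` with respect to the preorder induced by `M`. -/
def BoundedBy {A : Type*} [CommRing A] [Algebra ℝ A] (M : Set A) (ε : ℝ) (p : A) : Prop :=
  algebraMap ℝ A ε + p ∈ M ∧ algebraMap ℝ A ε - p ∈ M

namespace IsQuadraticModule

section Ring

variable {A : Type*} [CommRing A] {M : Set A}

lemma zero_mem (hM : IsQuadraticModule M) : (0 : A) ∈ M := by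
  simpa using hM.sq_mul_mem 0 hM.one_mem

lemma sq_mem (hM : IsQuadraticModule M) (a : A) : a ^ 2 ∈ M := by
  simpa using hM.sq_mul_mem a hM.one_mem

lemma sumSq_mul_mem (hM : IsQuadraticModule M) {s p : A} (hs : IsSumSq s) (hp : p ∈ M) :
    s * p ∈ M := by
  induction hs with
  | zero => simpa using hM.zero_mem
  | sq_add a _ ih =>
    rw [add_mul, ← sq]
    exact hM.add_mem (hM.sq_mul_mem a hp) ih

lemma sumSq_mem (hM : IsQuadraticModule M) {s : A} (hs : IsSumSq s) : s ∈ M := by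
  simpa using hM.sumSq_mul_mem hs hM.one_mem

lemma adjoin (hM : IsQuadraticModule M) (a : A) : IsQuadraticModule (adjoinElement M a) where
  one_mem := ⟨1, hM.one_mem, 0, .zero, by simp⟩
  add_mem := by
    rintro _ _ ⟨p, hp, s, hs, rfl⟩ ⟨q, hq, t, ht, rfl⟩
    exact ⟨p + q, hM.add_mem hp hq, s + t, hs.add ht, by ring⟩
  sq_mul_mem := by
    rintro b _ ⟨p, hp, s, hs, rfl⟩
    exact ⟨b ^ 2 * p, hM.sq_mul_mem b hp, b * b * s, (IsSumSq.mul_self b).mul hs, by ring⟩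

lemma subset_adjoin (a : A) : M ⊆ adjoinElement M a :=
  fun p hp ↦ ⟨p, hp, 0, .zero, by simp⟩

lemma self_mem_adjoin (hM : IsQuadraticModule M) (a : A) : a ∈ adjoinElement M a :=
  ⟨0, hM.zero_mem, 1, .one, by simp⟩

lemma exists_maximal (hM : IsQuadraticModule M) (hneg : (-1 : A) ∉ M) :
    ∃ S, M ⊆ S ∧ Maximal (fun S : Set A ↦ IsQuadraticModule S ∧ (-1 : A) ∉ S) S := by
  refine zorn_subset_nonempty {S | IsQuadraticModule S ∧ (-1 : A) ∉ S} ?_ M ⟨hM, hneg⟩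
  intro c hc hchain ⟨S₀, hS₀⟩
  refine ⟨⋃₀ c, ⟨⟨⟨S₀, hS₀, (hc hS₀).1.one_mem⟩, ?_, ?_⟩, ?_⟩, fun s hs ↦
    Set.subset_sUnion_of_mem hs⟩
  · rintro p q ⟨S, hS, hp⟩ ⟨T, hT, hq⟩
    rcases hchain.total hS hT with h | h
    · exact ⟨T, hT, (hc hT).1.add_mem (h hp) hq⟩
    · exact ⟨S, hS, (hc hS).1.add_mem hp (h hq)⟩
  · rintro a p ⟨S, hS, hp⟩
    exact ⟨S, hS, (hc hS).1.sq_mul_mem a hp⟩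
  · rintro ⟨S, hS, h⟩
    exact (hc hS).2 h

end Ring

section RealAlgebra

variable {A : Type*} [CommRing A] [Algebra ℝ A] {M : Set A}

lemma algebraMap_mul_mem (hM : IsQuadraticModule M) {c : ℝ} (hc : 0 ≤ c) {p : A} (hp : p ∈ M) :
    algebraMap ℝ A c * p ∈ M := by
  rw [← Real.sq_sqrt hc, map_pow]
  exact hM.sq_mul_mem _ hp

lemma algebraMap_mem (hM : IsQuadraticModule M) {c : ℝ} (hc : 0 ≤ c) : algebraMap ℝ A c ∈ M := by
  simpa using hM.algebraMap_mul_mem hc hM.one_mem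

lemma nonneg_of_algebraMap_mem (hM : IsQuadraticModule M) (hneg : (-1 : A) ∉ M) {c : ℝ}
    (hc : algebraMap ℝ A c ∈ M) : 0 ≤ c := by
  by_contra! h
  refine hneg ?_
  have := hM.algebraMap_mul_mem (c := -c⁻¹) (by simpa using h.le) hc
  rwa [← map_mul, neg_mul, inv_mul_cancel₀ h.ne, map_neg, map_one] at this

lemma mul_mem_of_add_eq (hM : IsQuadraticModule M) {c : ℝ} (hc : 0 < c) {u v : A}
    (hu : u ∈ M) (hv : v ∈ M) (huv : u + v = algebraMap ℝ A c) : u * v ∈ M := by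
  have h := hM.algebraMap_mul_mem (inv_nonneg.2 hc.le)
    (hM.add_mem (hM.sq_mul_mem u hv) (hM.sq_mul_mem v hu))
  convert h using 1
  have h1 : algebraMap ℝ A c⁻¹ * algebraMap ℝ A c = 1 := by
    rw [← map_mul, inv_mul_cancel₀ hc.ne', map_one]
  linear_combination (-(u * v)) * h1 - algebraMap ℝ A c⁻¹ * u * v * huv

/-- In a maximal proper quadratic module every element has a sign. -/
lemma mem_or_neg_mem_of_maximal {S : Set A}
    (hS : Maximal (fun S : Set A ↦ IsQuadraticModule S ∧ (-1 : A) ∉ S) S) (a : A) :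
    a ∈ S ∨ -a ∈ S := by
  obtain ⟨hQ, hneg⟩ := hS.prop
  have key : ∀ b, b ∉ S → (-1 : A) ∈ adjoinElement S b := by
    intro b hb
    by_contra h
    exact hb (hS.le_of_ge ⟨hQ.adjoin b, h⟩ (subset_adjoin b) (hQ.self_mem_adjoin b))
  by_contra! h
  obtain ⟨s, hs, σ, hσ, h₁⟩ := key a h.1
  obtain ⟨t, ht, τ, hτ, h₂⟩ := key (-a) h.2
  have hσ' : -σ ∈ S := by
    have : -σ = τ + (τ * s + σ * t) := by linear_combination τ * h₁ + σ * h₂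
    rw [this]
    exact hQ.add_mem (hQ.sumSq_mem hτ)
      (hQ.add_mem (hQ.sumSq_mul_mem hτ hs) (hQ.sumSq_mul_mem hσ ht))
  refine hneg ?_
  have hquarter : algebraMap ℝ A (1 / 4) * 4 = 1 := by
    rw [← map_ofNat (algebraMap ℝ A) 4, ← map_mul]; norm_num
  have : (-1 : A) = s + algebraMap ℝ A (1 / 4) * ((a + 1) ^ 2 * σ + (a - 1) ^ 2 * (-σ)) := by
    linear_combination h₁ - σ * a * hquarter
  rw [this]
  exact hQ.add_mem hs (hQ.algebraMap_mul_mem (by norm_num)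
    (hQ.add_mem (hQ.sq_mul_mem _ (hQ.sumSq_mem hσ)) (hQ.sq_mul_mem _ hσ')))

end RealAlgebra

end IsQuadraticModule

namespace BoundedBy

variable {A : Type*} [CommRing A] [Algebra ℝ A] {M : Set A} {ε δ : ℝ} {p q : A}

lemma mono (hM : IsQuadraticModule M) (h : BoundedBy M ε p) (hεδ : ε ≤ δ) : BoundedBy M δ p := by
  have hd := hM.algebraMap_mem (sub_nonneg.2 hεδ)
  constructor
  · convert hM.add_mem hd h.1 using 1
    rw [map_sub]; ring
  · convert hM.add_mem hd h.2 using 1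
    rw [map_sub]; ring

lemma zero (hM : IsQuadraticModule M) (hε : 0 ≤ ε) : BoundedBy M ε 0 := by
  simpa [BoundedBy] using hM.algebraMap_mem hε

lemma add (hM : IsQuadraticModule M) (hp : BoundedBy M ε p) (hq : BoundedBy M δ q) :
    BoundedBy M (ε + δ) (p + q) := by
  constructor
  · convert hM.add_mem hp.1 hq.1 using 1
    rw [map_add]; ring
  · convert hM.add_mem hp.2 hq.2 using 1
    rw [map_add]; ring

lemma neg (hp : BoundedBy M ε p) : BoundedBy M ε (-p) :=
  ⟨by simpa [sub_eq_add_neg] using hp.2, by simpa using hp.1⟩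

lemma sub (hM : IsQuadraticModule M) (hp : BoundedBy M ε p) (hq : BoundedBy M δ q) :
    BoundedBy M (ε + δ) (p - q) := by
  simpa [sub_eq_add_neg] using hp.add hM hq.neg

lemma smul_nonneg (hM : IsQuadraticModule M) {c : ℝ} (hc : 0 ≤ c) (hp : BoundedBy M ε p) :
    BoundedBy M (c * ε) (algebraMap ℝ A c * p) := by
  constructor
  · convert hM.algebraMap_mul_mem hc hp.1 using 1
    rw [map_mul]; ring
  · convert hM.algebraMap_mul_mem hc hp.2 using 1
    rw [map_mul]; ring

lemma smul (hM : IsQuadraticModule M) (c : ℝ) (hp : BoundedBy M ε p) :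
    BoundedBy M (|c| * ε) (algebraMap ℝ A c * p) := by
  rcases le_total 0 c with hc | hc
  · simpa [abs_of_nonneg hc] using hp.smul_nonneg hM hc
  · simpa [abs_of_nonpos hc] using (hp.smul_nonneg hM (neg_nonneg.2 hc)).neg

lemma sq (hM : IsQuadraticModule M) (hε : 0 < ε) (hp : BoundedBy M ε p) :
    BoundedBy M (ε ^ 2) (p ^ 2) := by
  constructor
  · exact hM.add_mem (hM.algebraMap_mem (sq_nonneg ε)) (hM.sq_mem p)
  · convert hM.mul_mem_of_add_eq (c := 2 * ε) (by positivity) hp.1 hp.2 ?_ using 1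
    · rw [map_pow]; ring
    · rw [map_mul, map_ofNat]; ring

lemma mul (hM : IsQuadraticModule M) (hεδ : 0 < ε + δ) (hp : BoundedBy M ε p)
    (hq : BoundedBy M δ q) : BoundedBy M ((ε + δ) ^ 2 / 2) (p * q) := by
  have h := (((hp.add hM hq).sq hM hεδ).sub hM ((hp.sub hM hq).sq hM hεδ)).smul_nonneg hM
    (c := 1 / 4) (by norm_num)
  convert h using 1
  · ring
  · have hquarter : algebraMap ℝ A (1 / 4) * 4 = 1 := by
      rw [← map_ofNat (algebraMap ℝ A) 4, ← map_mul]; norm_num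
    linear_combination (-(p * q)) * hquarter

lemma exists_infinitesimal_sub (hM : IsQuadraticModule M) (hneg : (-1 : A) ∉ M)
    (htotal : ∀ a, a ∈ M ∨ -a ∈ M) (hp : BoundedBy M ε p) :
    ∃ c : ℝ, ∀ δ > 0, BoundedBy M δ (p - algebraMap ℝ A c) := by
  set T : Set ℝ := {r | p - algebraMap ℝ A r ∈ M} with hT
  have hne : T.Nonempty := ⟨-ε, by simpa [hT, add_comm] using hp.1⟩
  have hbdd : BddAbove T := by
    refine ⟨ε, fun r hr ↦ ?_⟩
    have := hM.nonneg_of_algebraMap_mem hneg (c := ε - r) (by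
      convert hM.add_mem hp.2 hr using 1
      rw [map_sub]; ring)
    linarith
  refine ⟨sSup T, fun δ hδ ↦ ⟨?_, ?_⟩⟩
  · obtain ⟨r, hr, hlt⟩ := exists_lt_of_lt_csSup hne (sub_lt_self (sSup T) hδ)
    convert hM.add_mem (hM.algebraMap_mem (c := δ + r - sSup T) (by linarith)) hr using 1
    simp only [map_add, map_sub]; ring
  · have hnot : p - algebraMap ℝ A (sSup T + δ) ∉ M := fun h ↦ by
      have := le_csSup hbdd (show sSup T + δ ∈ T from h)
      linarith
    convert (htotal _).resolve_left hnot using 1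
    rw [map_add]; ring

end BoundedBy

namespace IsQuadraticModule

variable {ι : Type*} {M : Set (MvPolynomial ι ℝ)}

lemma exists_boundedBy [Fintype ι] (hM : IsQuadraticModule M) {N : ℝ}
    (hN : C N - ∑ i, X i ^ 2 ∈ M) (p : MvPolynomial ι ℝ) : ∃ B > 0, BoundedBy M B p := by
  classical
  induction p using MvPolynomial.induction_on with
  | C a =>
    refine ⟨|a| + 1, by positivity, ?_⟩
    rw [← algebraMap_eq]
    constructor
    · rw [← map_add]
      exact hM.algebraMap_mem (by linarith [neg_abs_le a])
    · rw [← map_sub]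
      exact hM.algebraMap_mem (by linarith [le_abs_self a])
  | add p q hp hq =>
    obtain ⟨B, hB, hp⟩ := hp
    obtain ⟨D, hD, hq⟩ := hq
    exact ⟨B + D, by positivity, hp.add hM hq⟩
  | mul_X p i hp =>
    obtain ⟨B, hB, hp⟩ := hp
    have hX : C N - X i ^ 2 ∈ M := by
      have hsum : ∑ j ∈ Finset.univ.erase i, (X j : MvPolynomial ι ℝ) ^ 2 ∈ M :=
        hM.sumSq_mem (IsSumSq.sum_sq _ _)
      convert hM.add_mem hN hsum using 1
      rw [← Finset.add_sum_erase _ _ (Finset.mem_univ i)]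
      ring
    have h2X : BoundedBy M (N + 1) (2 * X i : MvPolynomial ι ℝ) := by
      rw [BoundedBy, map_add, map_one, algebraMap_eq]
      constructor
      · convert hM.add_mem hX (hM.sq_mem (X i + 1)) using 1; ring
      · convert hM.add_mem hX (hM.sq_mem (X i - 1)) using 1; ring
    have hXb := (h2X.smul_nonneg hM (c := 1 / 2) (by norm_num)).mono hM
      (le_max_left _ 0)
    rw [← mul_assoc, ← map_ofNat (algebraMap ℝ (MvPolynomial ι ℝ)) 2, ← map_mul,
      show (1 / 2 * 2 : ℝ) = 1 by norm_num, map_one, one_mul] at hXb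
    exact ⟨_, by positivity, hp.mul hM (by positivity) hXb⟩

/-- A proper Archimedean quadratic module of real polynomials is nonnegative at some point. -/
lemma exists_point [Fintype ι] (hM : IsQuadraticModule M) {N : ℝ}
    (hN : C N - ∑ i, X i ^ 2 ∈ M) (hneg : -1 ∉ M) : ∃ x : ι → ℝ, ∀ p ∈ M, 0 ≤ eval x p := by
  obtain ⟨S, hMS, hS⟩ := hM.exists_maximal hneg
  obtain ⟨hQ, hnegS⟩ := hS.prop
  have hpoint : ∀ i : ι, ∃ c : ℝ, ∀ δ > 0,
      BoundedBy S δ (X i - algebraMap ℝ (MvPolynomial ι ℝ) c) := fun i ↦ by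
    obtain ⟨B, -, hB⟩ := hQ.exists_boundedBy (hMS hN) (X i)
    exact hB.exists_infinitesimal_sub hQ hnegS (mem_or_neg_mem_of_maximal hS)
  choose x hx using hpoint
  have hinf : ∀ p : MvPolynomial ι ℝ, ∀ δ > 0, BoundedBy S δ (p - C (eval x p)) := by
    intro p
    induction p using MvPolynomial.induction_on with
    | C a =>
      intro δ hδ
      simpa using BoundedBy.zero hQ hδ.le
    | add p q hp hq =>
      intro δ hδ
      convert ((hp (δ / 2) (by positivity)).add hQ (hq (δ / 2) (by positivity))) using 1
      · ring
      · simp only [map_add]; ring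
    | mul_X p i hp =>
      intro δ hδ
      obtain ⟨u, hu, hu₁, hu₂, hu₃⟩ : ∃ u > 0, 2 * u ^ 2 ≤ δ / 3 ∧
          |x i| * u ≤ δ / 3 ∧ |eval x p| * u ≤ δ / 3 := by
        have hlim : ∀ F : ℝ → ℝ, Continuous F → F 0 = 0 →
            ∀ᶠ u in nhdsWithin (0 : ℝ) (Set.Ioi 0), F u ≤ δ / 3 := by
          intro F hF h0
          have := (hF.tendsto' 0 0 h0).eventually (ge_mem_nhds (by positivity : 0 < δ / 3))
          exact this.filter_mono nhdsWithin_le_nhds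
        obtain ⟨u, ⟨⟨h₁, h₂⟩, h₃⟩, hu⟩ :=
          ((((hlim (fun u ↦ 2 * u ^ 2) (by fun_prop) (by simp)).and
            (hlim (fun u ↦ |x i| * u) (by fun_prop) (by simp))).and
            (hlim (fun u ↦ |eval x p| * u) (by fun_prop) (by simp))).and
            self_mem_nhdsWithin).exists
        exact ⟨u, hu, h₁, h₂, h₃⟩
      have h := (((hp u hu).mul hQ (by positivity) (hx i u hu)).add hQ
        ((hp u hu).smul hQ (x i))).add hQ ((hx i u hu).smul hQ (eval x p))
      convert h.mono hQ (δ := δ) (by linarith [show (u + u) ^ 2 / 2 = 2 * u ^ 2 by ring]) using 1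
      simp only [algebraMap_eq, map_mul, eval_X]
      ring
  refine ⟨x, fun p hp ↦ ?_⟩
  refine le_of_forall_pos_le_add fun δ hδ ↦ ?_
  refine hQ.nonneg_of_algebraMap_mem hnegS ?_
  convert hQ.add_mem (hinf p δ hδ).2 (hMS hp) using 1
  rw [map_add, algebraMap_eq]; ring

lemma sub_mem_of_sumSq_mul_sub_one_mem [Fintype ι] (hM : IsQuadraticModule M) {N : ℝ}
    (hN : C N - ∑ i, X i ^ 2 ∈ M) {f σ : MvPolynomial ι ℝ} (hσ : IsSumSq σ)
    (h : σ * f - 1 ∈ M) :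
    ∃ η > 0, ∀ r ≥ 0, f + C r ∈ M → f + C (r - η) ∈ M := by
  obtain ⟨B, hB, hBσ⟩ := hM.exists_boundedBy hN σ
  obtain ⟨D, hD, hDσ⟩ := hM.exists_boundedBy hN (σ ^ 2 * f)
  set k := B + D + 1
  have hk0 : 0 < k := by positivity
  refine ⟨k⁻¹ ^ 2, by positivity, fun r hr hfr ↦ ?_⟩
  have h₁ : σ * (C (2 * k) - σ) ∈ M :=
    hM.mul_mem_of_add_eq (c := 2 * k) (by positivity) (hM.sumSq_mem hσ)
      (hBσ.mono hM (by linarith)).2 (by rw [algebraMap_eq]; ring)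
  have h₂ : C (2 * k - 1) - σ ^ 2 * f ∈ M := (hDσ.mono hM (by linarith)).2
  have h₃ := hM.add_mem (hM.add_mem (hM.sq_mul_mem (C k - σ) hfr)
    (hM.algebraMap_mul_mem (c := 2 * k) (by positivity) h))
    (hM.add_mem (hM.algebraMap_mul_mem hr h₁) h₂)
  convert hM.sq_mul_mem (C k⁻¹) h₃ using 1
  have hkk : (C k⁻¹ * C k : MvPolynomial ι ℝ) = 1 := by
    rw [← map_mul, inv_mul_cancel₀ hk0.ne', map_one]
  simp only [algebraMap_eq, map_sub, map_mul, map_pow, map_one, map_ofNat]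
  linear_combination (-(C k⁻¹ * C k + 1) * (f + C r)) * hkk

/-- **Putinar's Positivstellensatz**: an Archimedean quadratic module contains every polynomial
that is positive on its nonnegativity set. -/
theorem mem_of_pos [Fintype ι] (hM : IsQuadraticModule M) {N : ℝ}
    (hN : C N - ∑ i, X i ^ 2 ∈ M) {f : MvPolynomial ι ℝ}
    (hf : ∀ x : ι → ℝ, (∀ p ∈ M, 0 ≤ eval x p) → 0 < eval x f) : f ∈ M := by
  have hadj : -1 ∈ adjoinElement M (-f) := by
    by_contra h
    obtain ⟨x, hx⟩ := (hM.adjoin (-f)).exists_point (subset_adjoin _ hN) h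
    have h₁ := hf x fun p hp ↦ hx p (subset_adjoin _ hp)
    have h₂ := hx _ (hM.self_mem_adjoin (-f))
    rw [map_neg] at h₂
    linarith
  obtain ⟨s, hs, σ, hσ, hsσ⟩ := hadj
  obtain ⟨η, hη, hstep⟩ := hM.sub_mem_of_sumSq_mul_sub_one_mem hN (f := f) hσ (by
    convert hs using 1
    linear_combination hsσ)
  obtain ⟨B, hB, hfB⟩ := hM.exists_boundedBy hN f
  have hmem : ∀ r ≤ 0, f + C r ∈ M → f ∈ M := by
    intro r hr h
    convert hM.add_mem h (hM.algebraMap_mem (neg_nonneg.2 hr)) using 1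
    simp [algebraMap_eq]
  have hdescent : ∀ j : ℕ, f ∈ M ∨ f + C (B - j * η) ∈ M := by
    intro j
    induction j with
    | zero => right; simpa [add_comm, algebraMap_eq] using hfB.1
    | succ j ih =>
      refine ih.elim .inl fun h ↦ ?_
      rcases le_total (B - j * η) 0 with hr | hr
      · exact .inl (hmem _ hr h)
      · right
        convert hstep _ hr h using 3
        push_cast; ring
  obtain ⟨j, hj⟩ := exists_nat_gt (B / η)
  rw [div_lt_iff₀ hη] at hj
  exact (hdescent j).elim id (hmem _ (by linarith))

end IsQuadraticModule

lemma IsSumSq.isSOS {n : ℕ} {q : MvPolynomial (Fin n) ℝ} (hq : IsSumSq q) : IsSOS q := by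
  induction hq with
  | zero => exact ⟨0, 0, by simp⟩
  | sq_add a _ ih =>
    obtain ⟨t, h, rfl⟩ := ih
    exact ⟨t + 1, Fin.cons a h, by simp [Fin.sum_univ_succ, sq]⟩

lemma IsSOS.isSumSq {n : ℕ} {q : MvPolynomial (Fin n) ℝ} (hq : IsSOS q) : IsSumSq q := by
  obtain ⟨t, h, rfl⟩ := hq
  exact IsSumSq.sum_sq _ _

lemma IsSumSq.map {R S : Type*} [CommRing R] [CommRing S] (φ : R →+* S) {q : R}
    (hq : IsSumSq q) : IsSumSq (φ q) := by
  induction hq with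
  | zero => simp
  | sq_add a _ ih => simpa using .sq_add (φ a) ih

/-- The quadratic module generated by a finite family. -/
def finiteQuadraticModule {A : Type*} [CommRing A] {m : ℕ} (g : Fin m → A) : Set A :=
  {p | ∃ (σ0 : A) (σ : Fin m → A), IsSumSq σ0 ∧ (∀ j, IsSumSq (σ j)) ∧ p = σ0 + ∑ j, σ j * g j}

lemma isQuadraticModule_finiteQuadraticModule {A : Type*} [CommRing A] {m : ℕ} (g : Fin m → A) :
    IsQuadraticModule (finiteQuadraticModule g) where
  one_mem := ⟨1, 0, .one, fun _ ↦ .zero, by simp⟩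
  add_mem := by
    rintro _ _ ⟨σ0, σ, hσ0, hσ, rfl⟩ ⟨τ0, τ, hτ0, hτ, rfl⟩
    refine ⟨σ0 + τ0, σ + τ, hσ0.add hτ0, fun j ↦ (hσ j).add (hτ j), ?_⟩
    simp only [Pi.add_apply, add_mul, Finset.sum_add_distrib]
    ring
  sq_mul_mem := by
    rintro a _ ⟨σ0, σ, hσ0, hσ, rfl⟩
    have ha : IsSumSq (a ^ 2) := by rw [sq]; exact .mul_self a
    refine ⟨a ^ 2 * σ0, fun j ↦ a ^ 2 * σ j, ha.mul hσ0, fun j ↦ ha.mul (hσ j), ?_⟩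
    simp only [mul_add, Finset.mul_sum, mul_assoc]

lemma mem_finiteQuadraticModule {A : Type*} [CommRing A] {m : ℕ} (g : Fin m → A) (j : Fin m) :
    g j ∈ finiteQuadraticModule g :=
  ⟨0, Pi.single j 1, .zero, fun i ↦ by
    obtain rfl | hij := eq_or_ne i j
    · simp
    · simp [hij], by simp [Pi.single_apply]⟩

/-- The character `a ↦ (-1) ^ a` of `ZMod 2`. -/
noncomputable def parityChar : AddChar (ZMod 2) ℝ :=
  AddChar.zmodChar 2 (ζ := -1) (by norm_num)

lemma parityChar_eq_neg_one {a : ZMod 2} (ha : a ≠ 0) : parityChar a = -1 := by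
  obtain rfl : a = 1 := by revert a; decide
  simp [parityChar, AddChar.zmodChar_apply, ZMod.val_one]

section SignFlip

variable {n : ℕ}

/-- The parity of the exponent `α` along `s`. -/
def signPairing (s : Fin n → ZMod 2) (α : Fin n →₀ ℕ) : ZMod 2 := ∑ i, s i * (α i : ZMod 2)

lemma signPairing_add (s t : Fin n → ZMod 2) (α : Fin n →₀ ℕ) :
    signPairing (s + t) α = signPairing s α + signPairing t α := by
  simp [signPairing, add_mul, Finset.sum_add_distrib]

/-- The substitution `X i ↦ (-1) ^ (s i) * X i`. -/
noncomputable def signFlip (s : Fin n → ZMod 2) :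
    MvPolynomial (Fin n) ℝ →ₐ[ℝ] MvPolynomial (Fin n) ℝ :=
  aeval fun i ↦ C (parityChar (s i)) * X i

lemma signFlip_monomial (s : Fin n → ZMod 2) (α : Fin n →₀ ℕ) (c : ℝ) :
    signFlip s (monomial α c) = monomial α (parityChar (signPairing s α) * c) := by
  have hsum : parityChar (signPairing s α) = ∏ i, parityChar (s i) ^ α i := by
    refine (map_prod parityChar.toMonoidHom (fun i ↦ .ofAdd (s i * (α i : ZMod 2))) _).trans ?_
    refine Finset.prod_congr rfl fun i _ ↦ ?_
    have h : s i * (α i : ZMod 2) = α i • s i := by rw [nsmul_eq_mul, mul_comm]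
    exact (congrArg parityChar h).trans (parityChar.map_nsmul_eq_pow _ _)
  rw [signFlip, aeval_monomial, Finsupp.prod_fintype _ _ (by simp), monomial_eq, hsum,
    Finsupp.prod_fintype _ _ (by simp)]
  simp only [mul_pow, Finset.prod_mul_distrib, algebraMap_eq, map_mul, map_prod, map_pow]
  ring

lemma coeff_signFlip (s : Fin n → ZMod 2) (α : Fin n →₀ ℕ) (p : MvPolynomial (Fin n) ℝ) :
    coeff α (signFlip s p) = parityChar (signPairing s α) * coeff α p := by
  classical
  induction p using MvPolynomial.induction_on' with
  | monomial u a =>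
    rw [signFlip_monomial, coeff_monomial, coeff_monomial]
    split_ifs with h
    · rw [h]
    · simp
  | add p q hp hq => rw [map_add, coeff_add, coeff_add, hp, hq, mul_add]

lemma signFlip_eq_self {s : Fin n → ZMod 2} {p : MvPolynomial (Fin n) ℝ}
    (h : ∀ α ∈ p.support, signPairing s α = 0) : signFlip s p = p := by
  ext α
  rw [coeff_signFlip]
  by_cases hα : α ∈ p.support
  · rw [h α hα, AddChar.map_zero_eq_one, one_mul]
  · rw [notMem_support_iff.1 hα, mul_zero]

/-- The average of `p` over the sign flips in `G`. -/
noncomputable def signAverage (G : Finset (Fin n → ZMod 2)) (p : MvPolynomial (Fin n) ℝ) :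
    MvPolynomial (Fin n) ℝ :=
  C (G.card : ℝ)⁻¹ * ∑ s ∈ G, signFlip s p

lemma isSumSq_signAverage (G : Finset (Fin n → ZMod 2)) {p : MvPolynomial (Fin n) ℝ}
    (hp : IsSumSq p) : IsSumSq (signAverage G p) := by
  refine IsSumSq.mul ?_ (IsSumSq.sum fun s _ ↦ hp.map (signFlip s).toRingHom)
  rw [← Real.mul_self_sqrt (inv_nonneg.2 (Nat.cast_nonneg G.card)), map_mul]
  exact .mul_self _

lemma signAverage_eq_self {G : Finset (Fin n → ZMod 2)} (hG : G.Nonempty)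
    {p : MvPolynomial (Fin n) ℝ} (h : ∀ s ∈ G, signFlip s p = p) : signAverage G p = p := by
  have hcard : (G.card : ℝ) ≠ 0 := by simpa using hG.ne_empty
  rw [signAverage, Finset.sum_congr rfl h, Finset.sum_const, nsmul_eq_mul, ← mul_assoc,
    ← map_natCast C, ← map_mul, inv_mul_cancel₀ hcard, map_one, one_mul]

lemma signAverage_add (G : Finset (Fin n → ZMod 2)) (p q : MvPolynomial (Fin n) ℝ) :
    signAverage G (p + q) = signAverage G p + signAverage G q := by
  simp only [signAverage, map_add, Finset.sum_add_distrib, mul_add]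

lemma signAverage_sum {ι : Type*} (G : Finset (Fin n → ZMod 2)) (J : Finset ι)
    (p : ι → MvPolynomial (Fin n) ℝ) :
    signAverage G (∑ j ∈ J, p j) = ∑ j ∈ J, signAverage G (p j) := by
  simp only [signAverage, map_sum, Finset.mul_sum]
  exact Finset.sum_comm

lemma signAverage_mul_of_invariant {G : Finset (Fin n → ZMod 2)} {q : MvPolynomial (Fin n) ℝ}
    (h : ∀ s ∈ G, signFlip s q = q) (p : MvPolynomial (Fin n) ℝ) :
    signAverage G (p * q) = signAverage G p * q := by
  rw [signAverage, signAverage, mul_assoc, Finset.sum_mul]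
  congr 1
  exact Finset.sum_congr rfl fun s hs ↦ by rw [map_mul, h s hs]

lemma signPairing_eq_zero_of_mem_support_signAverage {G : Finset (Fin n → ZMod 2)}
    (hG : ∀ s ∈ G, ∀ t ∈ G, s + t ∈ G) {p : MvPolynomial (Fin n) ℝ} {α : Fin n →₀ ℕ}
    (hα : α ∈ (signAverage G p).support) {t : Fin n → ZMod 2} (ht : t ∈ G) :
    signPairing t α = 0 := by
  by_contra hne
  refine mem_support_iff.1 hα ?_
  have htt : ∀ s : Fin n → ZMod 2, s + t + t = s := fun s ↦ by
    ext i; simp [add_assoc, CharTwo.add_self_eq_zero]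
  rw [signAverage, coeff_C_mul, coeff_sum]
  have hsum : ∑ s ∈ G, coeff α (signFlip s p) = -∑ s ∈ G, coeff α (signFlip s p) := by
    rw [← Finset.sum_neg_distrib]
    refine Finset.sum_bij' (fun s _ ↦ s + t) (fun s _ ↦ s + t) (fun s hs ↦ hG s hs t ht)
      (fun s hs ↦ hG s hs t ht) (fun s _ ↦ htt s) (fun s _ ↦ htt s) fun s _ ↦ ?_
    rw [coeff_signFlip, coeff_signFlip, signPairing_add, AddChar.map_add_eq_mul,
      parityChar_eq_neg_one hne]
    ring
  rw [self_eq_neg.1 hsum, mul_zero]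

end SignFlip

/-- **Sign-symmetry-adapted Putinar representation**: if the quadratic module `M(g)` is
Archimedean and `f > 0` on `X = {x : g_j(x) ≥ 0 ∀ j}`, then `f = σ₀ + Σ_j σ_j·g_j` for sums of
squares `σ_j` such that every exponent in the support of every `σ_j` is annihilated (mod 2) by
every sign symmetry of `A = supp f ∪ ⋃_j supp g_j`. -/
theorem sign_symmetry_putinar (n m : ℕ)
    (f : MvPolynomial (Fin n) ℝ) (g : Fin m → MvPolynomial (Fin n) ℝ)
    (K : Set (Fin n → ℝ)) (hK : K = {x | ∀ j, 0 ≤ eval x (g j)})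
    (harch : ∃ N : ℝ, 0 < N ∧
      ∃ (σ0 : MvPolynomial (Fin n) ℝ) (σ : Fin m → MvPolynomial (Fin n) ℝ),
        IsSOS σ0 ∧ (∀ j, IsSOS (σ j)) ∧
        C N - ∑ i, X i ^ 2 = σ0 + ∑ j, σ j * g j)
    (hfpos : ∀ x ∈ K, 0 < eval x f) :
    ∃ (σ0 : MvPolynomial (Fin n) ℝ) (σ : Fin m → MvPolynomial (Fin n) ℝ),
      IsSOS σ0 ∧ (∀ j, IsSOS (σ j)) ∧
      f = σ0 + ∑ j, σ j * g j ∧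
      ∀ s : Fin n → ZMod 2,
        (∀ α : Fin n →₀ ℕ, (α ∈ f.support ∨ ∃ j, α ∈ (g j).support) →
          ∑ i, s i * (α i : ZMod 2) = 0) →
        (∀ α ∈ σ0.support, ∑ i, s i * (α i : ZMod 2) = 0) ∧
        ∀ j, ∀ α ∈ (σ j).support, ∑ i, s i * (α i : ZMod 2) = 0 := by
  classical
  subst hK
  obtain ⟨N, -, τ0, τ, hτ0, hτ, hN⟩ := harch
  have hfmem : f ∈ finiteQuadraticModule g :=
    (isQuadraticModule_finiteQuadraticModule g).mem_of_pos (N := N)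
      ⟨τ0, τ, hτ0.isSumSq, fun j ↦ (hτ j).isSumSq, hN⟩
      fun x hx ↦ hfpos x fun j ↦ hx _ (mem_finiteQuadraticModule g j)
  obtain ⟨σ0, σ, hσ0, hσ, hfσ⟩ := hfmem
  set G : Finset (Fin n → ZMod 2) := {s | ∀ α : Fin n →₀ ℕ,
    (α ∈ f.support ∨ ∃ j, α ∈ (g j).support) → signPairing s α = 0} with hGdef
  have hG0 : G.Nonempty := ⟨0, by simp [hGdef, signPairing]⟩
  have hGadd : ∀ s ∈ G, ∀ t ∈ G, s + t ∈ G := by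
    intro s hs t ht
    rw [hGdef, Finset.mem_filter_univ] at hs ht ⊢
    intro α hα
    rw [signPairing_add, hs α hα, ht α hα, add_zero]
  have hGf : ∀ s ∈ G, signFlip s f = f := fun s hs ↦
    signFlip_eq_self fun α hα ↦ (Finset.mem_filter_univ s).1 hs α (.inl hα)
  have hGg : ∀ j, ∀ s ∈ G, signFlip s (g j) = g j := fun j s hs ↦
    signFlip_eq_self fun α hα ↦ (Finset.mem_filter_univ s).1 hs α (.inr ⟨j, hα⟩)
  refine ⟨signAverage G σ0, fun j ↦ signAverage G (σ j), (isSumSq_signAverage G hσ0).isSOS,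
    fun j ↦ (isSumSq_signAverage G (hσ j)).isSOS, ?_, fun s hs ↦ ?_⟩
  · rw [← signAverage_eq_self hG0 hGf, hfσ, signAverage_add, signAverage_sum]
    exact congrArg _ (Finset.sum_congr rfl fun j _ ↦ signAverage_mul_of_invariant (hGg j) _)
  · have hsG : s ∈ G := (Finset.mem_filter_univ s).2 hs
    exact ⟨fun α hα ↦ signPairing_eq_zero_of_mem_support_signAverage hGadd hα hsG,
      fun j α hα ↦ signPairing_eq_zero_of_mem_support_signAverage hGadd hα hsG⟩
end

section
/- There exist polynomials which are sparse sums of hermitian squares but are not sums of sparse hermitian squares: there exists f ∈ ℝ⟨x₁,x₂,x₃⟩ such that f is a sum of hermitian squares, f = f₁ + f₂ with f₁ in the subalgebra generated by x₁ and x₂ and f₂ in the subalgebra generated by x₂ and x₃, and yet f cannot be written as s₁ + s₂ where s₁ is a sum of hermitian squares of elements of the subalgebra generated by x₁ and x₂ and s₂ is a sum of hermitian squares of elements of the subalgebra generated by x₂ and x₃. -/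
open FreeAlgebra Polynomial

/-- Evaluation of a noncommutative polynomial at a point of a commutative algebra is blind to
the involution. -/
theorem FreeAlgebra.lift_star {X A : Type*} [CommRing A] [Algebra ℝ A] (v : X → A)
    (p : FreeAlgebra ℝ X) : lift ℝ v (star p) = lift ℝ v p := by
  induction p using FreeAlgebra.induction with
  | grade0 r => simp [FreeAlgebra.star_algebraMap]
  | grade1 x => simp
  | mul a b ha hb => simp [ha, hb, mul_comm]
  | add a b ha hb => simp [ha, hb]

/-- Evaluations at points agreeing on a set of letters agree on the subalgebra they generate. -/
theorem FreeAlgebra.lift_eq_of_mem_adjoin {X A : Type*} [CommRing A] [Algebra ℝ A] {v w : X → A}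
    {i j : X} (hi : v i = w i) (hj : v j = w j) {p : FreeAlgebra ℝ X}
    (hp : p ∈ Algebra.adjoin ℝ {ι ℝ i, ι ℝ j}) : lift ℝ v p = lift ℝ w p := by
  have hle : Algebra.adjoin ℝ {ι ℝ i, ι ℝ j} ≤ AlgHom.equalizer (lift ℝ v) (lift ℝ w) := by
    rw [Algebra.adjoin_le_iff]
    rintro _ (rfl | rfl)
    · simpa [AlgHom.mem_equalizer] using hi
    · simpa [AlgHom.mem_equalizer] using hj
  exact hle hp

/-- A real polynomial bounded by both `|t|` and `t ^ 2` vanishes. -/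
theorem Polynomial.eq_zero_of_abs_eval_le {p : ℝ[X]} (h1 : ∀ t, |p.eval t| ≤ |t|)
    (h2 : ∀ t, |p.eval t| ≤ t ^ 2) : p = 0 := by
  obtain ⟨q, rfl⟩ : X ∣ p := by
    rw [X_dvd_iff, coeff_zero_eq_eval_zero]
    simpa using h1 0
  have hq : q.degree ≤ 0 := by
    rw [← isBoundedUnder_abs_atTop_iff]
    refine Filter.isBoundedUnder_of_eventually_le (a := 1) ?_
    filter_upwards [Filter.eventually_gt_atTop (0 : ℝ)] with t ht
    have := h1 t
    rw [eval_mul, eval_X, abs_mul] at this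
    exact le_of_mul_le_mul_left (by simpa using this) (abs_pos.2 ht.ne')
  rw [eq_C_of_degree_le_zero hq] at h2 ⊢
  set b := q.coeff 0
  have := (le_abs_self _).trans (h2 (b / 2))
  simp only [eval_mul, eval_X, eval_C] at this
  have hb : b = 0 := by nlinarith
  simp [hb]

/-- **Sparse sums of hermitian squares need not be sums of sparse hermitian squares**: there is
a noncommutative polynomial `f ∈ ℝ⟨x₁,x₂,x₃⟩` which is a sum of hermitian squares and splits as
`f = f₁ + f₂` with `f₁ ∈ ℝ⟨x₁,x₂⟩` and `f₂ ∈ ℝ⟨x₂,x₃⟩`, yet `f` is not the sum of a sum of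
hermitian squares of elements of `ℝ⟨x₁,x₂⟩` and one of elements of `ℝ⟨x₂,x₃⟩`. -/
theorem exists_sparse_sohs_not_sum_of_sparse_hermitian_squares :
    ∃ f : FreeAlgebra ℝ (Fin 3),
      (∃ (t : ℕ) (h : Fin t → FreeAlgebra ℝ (Fin 3)),
        f = ∑ i, star (h i) * h i) ∧
      (∃ f₁ f₂ : FreeAlgebra ℝ (Fin 3),
        f = f₁ + f₂ ∧
        f₁ ∈ Algebra.adjoin ℝ
          {FreeAlgebra.ι ℝ (0 : Fin 3), FreeAlgebra.ι ℝ (1 : Fin 3)} ∧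
        f₂ ∈ Algebra.adjoin ℝ
          {FreeAlgebra.ι ℝ (1 : Fin 3), FreeAlgebra.ι ℝ (2 : Fin 3)}) ∧
      ¬ ∃ s₁ s₂ : FreeAlgebra ℝ (Fin 3),
          (∃ (t : ℕ) (h : Fin t → FreeAlgebra ℝ (Fin 3)),
            (∀ i, h i ∈ Algebra.adjoin ℝ
              {FreeAlgebra.ι ℝ (0 : Fin 3), FreeAlgebra.ι ℝ (1 : Fin 3)}) ∧
            s₁ = ∑ i, star (h i) * h i) ∧
          (∃ (t : ℕ) (h : Fin t → FreeAlgebra ℝ (Fin 3)),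
            (∀ i, h i ∈ Algebra.adjoin ℝ
              {FreeAlgebra.ι ℝ (1 : Fin 3), FreeAlgebra.ι ℝ (2 : Fin 3)}) ∧
            s₂ = ∑ i, star (h i) * h i) ∧
          f = s₁ + s₂ := by
  let E (a b c : ℝ) : FreeAlgebra ℝ (Fin 3) →ₐ[ℝ] ℝ := lift ℝ ![a, b, c]
  have hstar (a b c : ℝ) (p) : E a b c (star p) = E a b c p := lift_star _ p
  set x : FreeAlgebra ℝ (Fin 3) := ι ℝ 0
  set y : FreeAlgebra ℝ (Fin 3) := ι ℝ 1
  set z : FreeAlgebra ℝ (Fin 3) := ι ℝ 2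
  have sx : star x = x := star_ι 0
  have sy : star y = y := star_ι 1
  have sz : star z = z := star_ι 2
  refine ⟨star (x + y * z + y) * (x + y * z + y) + star (z - y * x) * (z - y * x),
    ⟨2, ![x + y * z + y, z - y * x], by simp [Fin.sum_univ_two]⟩,
    ⟨x * x + x * y * y * x + x * y + y * x, z * z + z * y * y * z + z * y * y + y * y * z + y * y,
      ?_, ?_, ?_⟩, ?_⟩
  · simp only [star_add, star_sub, star_mul, sx, sy, sz]
    noncomm_ring
  · have mx : x ∈ Algebra.adjoin ℝ {x, y} := Algebra.subset_adjoin (by simp)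
    have my : y ∈ Algebra.adjoin ℝ {x, y} := Algebra.subset_adjoin (by simp)
    apply_rules [add_mem, mul_mem]
  · have my : y ∈ Algebra.adjoin ℝ {y, z} := Algebra.subset_adjoin (by simp)
    have mz : z ∈ Algebra.adjoin ℝ {y, z} := Algebra.subset_adjoin (by simp)
    apply_rules [add_mem, mul_mem]
  rintro ⟨_, _, ⟨m, h, hh, rfl⟩, ⟨n, g, hg, rfl⟩, hf⟩
  have key (a b c : ℝ) : (a + b * c + b) ^ 2 + (c - b * a) ^ 2
      = ∑ i, E a b 0 (h i) ^ 2 + ∑ j, E 0 b c (g j) ^ 2 := by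
    have hh' (i) : E a b c (h i) = E a b 0 (h i) :=
      lift_eq_of_mem_adjoin (v := ![a, b, c]) (w := ![a, b, 0]) rfl rfl (hh i)
    have hg' (j) : E a b c (g j) = E 0 b c (g j) :=
      lift_eq_of_mem_adjoin (v := ![a, b, c]) (w := ![0, b, c]) rfl rfl (hg j)
    have ex : E a b c x = a := by simp [E, x]
    have ey : E a b c y = b := by simp [E, y]
    have ez : E a b c z = c := by simp [E, z]
    have := congrArg (E a b c) hf
    simp only [map_add, map_mul, map_sub, map_sum, hstar, ex, ey, ez, hh', hg'] at this
    simpa only [sq] using this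
  have hH (a b : ℝ) : 0 ≤ ∑ i, E a b 0 (h i) ^ 2 := Finset.sum_nonneg fun _ _ => sq_nonneg _
  have hG (b c : ℝ) : 0 ≤ ∑ j, E 0 b c (g j) ^ 2 := Finset.sum_nonneg fun _ _ => sq_nonneg _
  have hg0 (j) (t : ℝ) : E 0 t 0 (g j) = 0 := by
    let P : FreeAlgebra ℝ (Fin 3) →ₐ[ℝ] ℝ[X] := lift ℝ ![0, X, 0]
    have hP (t : ℝ) : (P (g j)).eval t = E 0 t 0 (g j) := by
      have : (aeval t).comp P = E 0 t 0 := by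
        ext i
        fin_cases i <;> simp [P, E]
      rw [← this, AlgHom.comp_apply, coe_aeval_eq_eval]
    have hle (t : ℝ) : E 0 t 0 (g j) ^ 2 ≤ ∑ j, E 0 t 0 (g j) ^ 2 :=
      Finset.single_le_sum (f := fun j => E 0 t 0 (g j) ^ 2) (fun _ _ => sq_nonneg _)
        (Finset.mem_univ j)
    have hzero : P (g j) = 0 := by
      refine eq_zero_of_abs_eval_le (fun t => ?_) (fun t => ?_) <;> rw [hP]
      · refine sq_le_sq.1 ?_
        linarith [key 0 t 0, hH 0 t, hle t]
      · refine abs_le_of_sq_le_sq ?_ (sq_nonneg t)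
        linarith [key (-t) t 0, hH (-t) t, hle t]
    rw [← hP, hzero, eval_zero]
  have k0 := key 0 2 0
  have k1 := key 0 2 (-1)
  simp only [hg0] at k0
  norm_num at k0 k1
  linarith [hG 2 (-1)]
end

section
/- SOS certificates bound the joint spectral radius: let A₁,…,A_m ∈ ℝ^{n×n} with m ≥ 1, let r ≥ 1 be an integer, let γ ≥ 0, and let p ∈ ℝ[x₁,…,xₙ] be a homogeneous polynomial of degree 2r with p(x) > 0 for all x ≠ 0, such that p(Aᵢx) ≤ γ^{2r}·p(x) for all x ∈ ℝⁿ and all i ∈ {1,…,m}. Then the joint spectral radius of {A₁,…,A_m} is at most γ; concretely, limsup_{k→∞} ( max over σ ∈ {1,…,m}^k of ‖A_{σ₁}A_{σ₂}⋯A_{σ_k}‖ )^{1/k} ≤ γ. -/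
open MvPolynomial Filter

/-- The operator norm of a real `n × n` matrix induced by the Euclidean norm. -/
noncomputable def matOpNorm {n : ℕ} (M : Matrix (Fin n) (Fin n) ℝ) : ℝ :=
  ‖Matrix.toEuclideanCLM (𝕜 := ℝ) M‖

/-- Scaling the argument of a homogeneous polynomial of degree `d` by `c` scales its value by
`c ^ d`. -/
theorem MvPolynomial.IsHomogeneous.eval_smul_arg {σ R : Type*} [CommSemiring R]
    {p : MvPolynomial σ R} {d : ℕ} (hp : p.IsHomogeneous d) (c : R) (x : σ → R) :
    eval (c • x) p = c ^ d * eval x p := by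
  rw [eval_eq, eval_eq, Finset.mul_sum]
  refine Finset.sum_congr rfl fun s hs => ?_
  have hdeg : ∑ i ∈ s.support, s i = d := by
    have h := hp (mem_support_iff.mp hs)
    rwa [Finsupp.weight_apply, Finsupp.sum,
      Finset.sum_congr rfl fun i _ => show s i • (1 : σ → ℕ) i = s i by simp] at h
  simp only [Pi.smul_apply, smul_eq_mul, mul_pow, Finset.prod_mul_distrib,
    Finset.prod_pow_eq_pow_sum, hdeg]
  ring

/-- A positive definite form of degree `d` is comparable to the `d`-th power of the Euclidean
norm. -/
theorem MvPolynomial.IsHomogeneous.exists_norm_pow_bounds {n d : ℕ} {p : MvPolynomial (Fin n) ℝ}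
    (hp : p.IsHomogeneous d) (hd : d ≠ 0) (hpos : ∀ x : Fin n → ℝ, x ≠ 0 → 0 < eval x p) :
    ∃ a b : ℝ, 0 < a ∧ ∀ x : EuclideanSpace ℝ (Fin n),
      a * ‖x‖ ^ d ≤ eval x.ofLp p ∧ eval x.ofLp p ≤ b * ‖x‖ ^ d := by
  have hcont : Continuous fun x : EuclideanSpace ℝ (Fin n) => eval x.ofLp p :=
    (MvPolynomial.continuous_eval p).comp (PiLp.continuous_ofLp 2 _)
  have hcpt : IsCompact (Metric.sphere (0 : EuclideanSpace ℝ (Fin n)) 1) := isCompact_sphere _ _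
  obtain ⟨b, hb⟩ := hcpt.bddAbove_image hcont.continuousOn
  obtain ⟨a, ha, hab⟩ : ∃ a : ℝ, 0 < a ∧ ∀ x ∈ Metric.sphere (0 : EuclideanSpace ℝ (Fin n)) 1,
      a ≤ eval x.ofLp p := by
    refine hcpt.exists_forall_le' hcont.continuousOn fun x hx => hpos _ fun h => ?_
    have hx0 : x = 0 := by ext i; simp [h]
    simp [hx0] at hx
  refine ⟨a, b, ha, fun x => ?_⟩
  rcases eq_or_ne x 0 with rfl | hx
  · have h := hp.eval_smul_arg 0 (0 : Fin n → ℝ)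
    rw [smul_zero, zero_pow hd, zero_mul] at h
    simp only [WithLp.ofLp_zero, h, norm_zero, zero_pow hd, mul_zero, le_refl, and_self]
  have hx0 : 0 < ‖x‖ := norm_pos_iff.mpr hx
  have hu : ‖x‖⁻¹ • x ∈ Metric.sphere (0 : EuclideanSpace ℝ (Fin n)) 1 := by
    simp [norm_smul, hx0.ne']
  have hscale : eval x.ofLp p = ‖x‖ ^ d * eval (‖x‖⁻¹ • x).ofLp p := by
    rw [← hp.eval_smul_arg, WithLp.ofLp_smul, smul_inv_smul₀ hx0.ne']
  rw [hscale, mul_comm a, mul_comm b]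
  exact ⟨by gcongr; exact hab _ hu, by gcongr; exact hb ⟨_, hu, rfl⟩⟩

/-- A contraction estimate for a functional along each matrix of a list iterates along their
product. -/
theorem List.apply_prod_mulVec_le {n : ℕ} (f : (Fin n → ℝ) → ℝ) {c : ℝ} (hc : 0 ≤ c)
    (L : List (Matrix (Fin n) (Fin n) ℝ))
    (hL : ∀ M ∈ L, ∀ x, f (M.mulVec x) ≤ c * f x) (x : Fin n → ℝ) :
    f (L.prod.mulVec x) ≤ c ^ L.length * f x := by
  induction L with
  | nil => simp
  | cons M L ih =>
    rw [List.prod_cons, ← Matrix.mulVec_mulVec, List.length_cons, pow_succ', mul_assoc]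
    exact (hL M (by simp) _).trans <|
      mul_le_mul_of_nonneg_left (ih fun N hN => hL N (by simp [hN])) hc

/-- **SOS certificates bound the joint spectral radius**: if `p` is a positive definite form of
degree `2r` with `p(Aᵢx) ≤ γ^{2r}·p(x)` for all `x` and `i`, then the joint spectral radius of
`{A₁,…,A_m}` is at most `γ`. -/
theorem sos_certificate_bounds_jsr (n m r : ℕ) (hm : 1 ≤ m) (hr : 1 ≤ r)
    (A : Fin m → Matrix (Fin n) (Fin n) ℝ) (γ : ℝ) (hγ : 0 ≤ γ)
    (p : MvPolynomial (Fin n) ℝ)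
    (hhom : p.IsHomogeneous (2 * r))
    (hpos : ∀ x : Fin n → ℝ, x ≠ 0 → 0 < eval x p)
    (hdec : ∀ (i : Fin m) (x : Fin n → ℝ),
      eval ((A i).mulVec x) p ≤ γ ^ (2 * r) * eval x p) :
    Filter.limsup (fun k : ℕ =>
        (⨆ σ : Fin k → Fin m, matOpNorm ((List.ofFn fun l => A (σ l)).prod)) ^ ((1 : ℝ) / k))
      Filter.atTop ≤ γ := by
  have hd : 2 * r ≠ 0 := by omega
  obtain ⟨a, b, ha, hab⟩ := hhom.exists_norm_pow_bounds hd hpos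
  set C : ℝ := max 1 (b / a)
  have hC1 : 1 ≤ C := le_max_left _ _
  have hbC : b ≤ a * C ^ (2 * r) := by
    rw [← div_le_iff₀' ha]
    exact (le_max_right _ _).trans (le_self_pow₀ hC1 hd)
  have hnorm (k : ℕ) (σ : Fin k → Fin m) :
      matOpNorm ((List.ofFn fun l => A (σ l)).prod) ≤ C * γ ^ k := by
    refine ContinuousLinearMap.opNorm_le_bound _ (by positivity) fun x => ?_
    set M := (List.ofFn fun l => A (σ l)).prod
    have h1 : eval (M.mulVec x.ofLp) p ≤ (γ ^ (2 * r)) ^ k * eval x.ofLp p := by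
      simpa using List.apply_prod_mulVec_le (fun y => eval y p) (by positivity)
        (List.ofFn fun l => A (σ l))
        (by simpa [List.mem_ofFn] using fun l => hdec (σ l)) x.ofLp
    have h2 := (hab (Matrix.toEuclideanCLM (𝕜 := ℝ) M x)).1
    rw [Matrix.ofLp_toEuclideanCLM] at h2
    refine le_of_pow_le_pow_left₀ hd (by positivity) (le_of_mul_le_mul_left ?_ ha)
    calc a * ‖Matrix.toEuclideanCLM (𝕜 := ℝ) M x‖ ^ (2 * r)
        ≤ (γ ^ (2 * r)) ^ k * eval x.ofLp p := h2.trans h1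
      _ ≤ (γ ^ (2 * r)) ^ k * ((a * C ^ (2 * r)) * ‖x‖ ^ (2 * r)) := by
          gcongr
          exact (hab x).2.trans (by gcongr)
      _ = a * (C * γ ^ k * ‖x‖) ^ (2 * r) := by ring
  have hsup_nonneg (k : ℕ) :
      0 ≤ ⨆ σ : Fin k → Fin m, matOpNorm ((List.ofFn fun l => A (σ l)).prod) :=
    Real.iSup_nonneg fun _ => norm_nonneg _
  have hlim : Tendsto (fun k : ℕ => C ^ ((1 : ℝ) / k) * γ) atTop (nhds γ) := by
    have h := ((Real.continuous_const_rpow (by positivity : C ≠ 0)).tendsto 0).comp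
      (tendsto_one_div_atTop_nhds_zero_nat (𝕜 := ℝ))
    simpa using h.mul_const γ
  rw [← hlim.limsup_eq]
  refine limsup_le_limsup ?_ ?_ hlim.isBoundedUnder_le
  · filter_upwards [eventually_ne_atTop 0] with k hk
    calc _ ≤ (C * γ ^ k) ^ ((1 : ℝ) / k) :=
          Real.rpow_le_rpow (hsup_nonneg k)
            (Real.iSup_le (hnorm k) (by positivity)) (by positivity)
      _ = C ^ ((1 : ℝ) / k) * γ := by
          rw [Real.mul_rpow (by positivity) (by positivity), one_div,
            Real.pow_rpow_inv_natCast hγ hk]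
  · exact isCoboundedUnder_le_of_le atTop (x := 0) fun k => Real.rpow_nonneg (hsup_nonneg k) _
end

section
/- Nonnegativity of circuit polynomials via the circuit number: let f = Σ_{α∈T} c_α·x^α − d·x^β be a circuit polynomial with trellis T = {α₁,…,α_q}, coefficients c_α > 0, d ∈ ℝ, and β a lattice point in the relative interior of the convex hull of T, with barycentric coordinates λ₁,…,λ_q and circuit number Θ_f = Π_{j=1}^q (c_{αⱼ}/λⱼ)^{λⱼ}. Then f is nonnegative on ℝⁿ if and only if f is a sum of monomial squares or |d| ≤ Θ_f. -/
open MvPolynomial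

theorem eval_monomial_eq_prod {n : ℕ} (x : Fin n → ℝ) (s : Fin n →₀ ℕ) (a : ℝ) :
    eval x (monomial s a) = a * ∏ i, x i ^ s i := by
  rw [eval_monomial, Finsupp.prod_fintype _ _ (fun i => pow_zero _)]

theorem Finsupp.exists_add_self_of_even {ι : Type*} [Finite ι] (s : ι →₀ ℕ)
    (hs : ∀ i, Even (s i)) : ∃ γ : ι →₀ ℕ, s = γ + γ := by
  choose g hg using hs
  exact ⟨Finsupp.equivFunOnFinite.symm g, Finsupp.ext fun i => by simpa using hg i⟩

/-- Real values on affinely independent points are interpolated by an affine function. -/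
theorem AffineIndependent.exists_affine_interpolation {n q : ℕ} {p : Fin q → Fin n → ℝ}
    (hp : AffineIndependent ℝ p) (w : Fin q → ℝ) :
    ∃ (y : Fin n → ℝ) (t : ℝ), ∀ j, ∑ i, p j i * y i + t = w j := by
  have hli : LinearIndependent ℝ (fun j => (p j, (1 : ℝ))) := by
    rw [Fintype.linearIndependent_iff]
    intro g hg j
    have h1 := congrArg Prod.fst hg
    have h2 := congrArg Prod.snd hg
    simp only [Prod.fst_sum, Prod.snd_sum, Prod.smul_mk, Prod.fst_zero, Prod.snd_zero,
      smul_eq_mul, mul_one] at h1 h2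
    exact affineIndependent_iff.1 hp Finset.univ g h2 h1 j (Finset.mem_univ j)
  obtain ⟨g, hg⟩ := LinearMap.exists_leftInverse_of_injective
    (Fintype.linearCombination ℝ (fun j => (p j, (1 : ℝ))))
    (LinearMap.ker_eq_bot.2 hli.fintypeLinearCombination_injective)
  let φ : (Fin n → ℝ) × ℝ →ₗ[ℝ] ℝ := (Fintype.linearCombination ℝ w) ∘ₗ g
  have hφ (j : Fin q) : φ (p j, 1) = w j := by
    have h := LinearMap.congr_fun hg (Pi.single j 1)
    simp only [LinearMap.comp_apply, Fintype.linearCombination_apply_single, one_smul,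
      LinearMap.id_apply] at h
    simp [φ, h, Fintype.linearCombination_apply_single]
  refine ⟨fun i => φ (Pi.single i 1, 0), φ (0, 1), fun j => ?_⟩
  have hsum := LinearMap.pi_apply_eq_sum_univ (φ ∘ₗ LinearMap.inl ℝ (Fin n → ℝ) ℝ) (p j)
  have hsplit : (p j, (1 : ℝ)) = (p j, 0) + (0, 1) := by simp
  rw [← hφ j, hsplit, map_add]
  congr 1
  simp only [LinearMap.comp_apply, LinearMap.inl_apply, smul_eq_mul] at hsum
  rw [hsum]
  refine Finset.sum_congr rfl fun i _ => ?_
  have hsingle : (Pi.single i 1 : Fin n → ℝ) = fun k => if i = k then 1 else 0 := by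
    ext k
    simp [Pi.single_apply, eq_comm]
  simp only [hsingle]

/-- Weighted AM-GM for monomials with even exponents. -/
theorem prod_rpow_mul_abs_prod_pow_le_sum {n q : ℕ} {α : Fin q → (Fin n →₀ ℕ)}
    (heven : ∀ j i, 2 ∣ α j i) {c : Fin q → ℝ} (hc : ∀ j, 0 < c j) {β : Fin n →₀ ℕ}
    {lam : Fin q → ℝ} (hlam : ∀ j, 0 < lam j) (hlamsum : ∑ j, lam j = 1)
    (hbary : ∀ i, (β i : ℝ) = ∑ j, lam j * (α j i : ℝ)) (x : Fin n → ℝ) :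
    (∏ j, (c j / lam j) ^ lam j) * |∏ i, x i ^ β i| ≤ ∑ j, c j * ∏ i, x i ^ α j i := by
  have habs (j : Fin q) : ∏ i, x i ^ α j i = ∏ i, |x i| ^ α j i :=
    Finset.prod_congr rfl fun i _ => ((even_iff_two_dvd.2 (heven j i)).pow_abs (x i)).symm
  have hnn (j : Fin q) : 0 ≤ ∏ i, |x i| ^ α j i := Finset.prod_nonneg fun i _ => by positivity
  have hdiv (j : Fin q) : 0 ≤ c j / lam j := (div_pos (hc j) (hlam j)).le
  have hβ : |∏ i, x i ^ β i| = ∏ j, (∏ i, |x i| ^ α j i) ^ lam j := by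
    have h (j : Fin q) : (∏ i, |x i| ^ α j i) ^ lam j = ∏ i, |x i| ^ (lam j * (α j i : ℝ)) := by
      rw [← Real.finsetProd_rpow _ _ (fun i _ => by positivity)]
      refine Finset.prod_congr rfl fun i _ => ?_
      rw [mul_comm, Real.rpow_mul (abs_nonneg _), Real.rpow_natCast]
    simp_rw [h]
    rw [Finset.prod_comm, Finset.abs_prod]
    refine Finset.prod_congr rfl fun i _ => ?_
    rw [← Real.rpow_sum_of_nonneg (abs_nonneg _)
      (fun j _ => mul_nonneg (hlam j).le (Nat.cast_nonneg _)), ← hbary, Real.rpow_natCast, abs_pow]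
  calc (∏ j, (c j / lam j) ^ lam j) * |∏ i, x i ^ β i|
      = ∏ j, (c j / lam j * ∏ i, |x i| ^ α j i) ^ lam j := by
        rw [hβ, ← Finset.prod_mul_distrib]
        exact Finset.prod_congr rfl fun j _ => (Real.mul_rpow (hdiv j) (hnn j)).symm
    _ ≤ ∑ j, lam j * (c j / lam j * ∏ i, |x i| ^ α j i) :=
        Real.geom_mean_le_arith_mean_weighted _ _ _ (fun j _ => (hlam j).le) hlamsum
          (fun j _ => mul_nonneg (hdiv j) (hnn j))
    _ = ∑ j, c j * ∏ i, x i ^ α j i := by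
        refine Finset.sum_congr rfl fun j _ => ?_
        rw [habs, ← mul_assoc, mul_div_cancel₀ _ (hlam j).ne']

/-- Equality in the weighted AM-GM inequality is attained at a point with positive coordinates. -/
theorem exists_pos_sum_eq_prod_rpow_mul {n q : ℕ} {α : Fin q → (Fin n →₀ ℕ)}
    (haff : AffineIndependent ℝ (fun j : Fin q => (fun i : Fin n => (α j i : ℝ))))
    {c : Fin q → ℝ} (hc : ∀ j, 0 < c j) {β : Fin n →₀ ℕ}
    {lam : Fin q → ℝ} (hlam : ∀ j, 0 < lam j) (hlamsum : ∑ j, lam j = 1)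
    (hbary : ∀ i, (β i : ℝ) = ∑ j, lam j * (α j i : ℝ)) :
    ∃ x : Fin n → ℝ, (∀ i, 0 < x i) ∧
      ∑ j, c j * ∏ i, x i ^ α j i = (∏ j, (c j / lam j) ^ lam j) * ∏ i, x i ^ β i := by
  obtain ⟨y, t, hy⟩ := haff.exists_affine_interpolation (fun j => Real.log (lam j / c j))
  refine ⟨fun i => Real.exp (y i), fun i => Real.exp_pos _, ?_⟩
  have hmon (s : Fin n →₀ ℕ) : ∏ i, Real.exp (y i) ^ s i = Real.exp (∑ i, (s i : ℝ) * y i) := by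
    rw [Real.exp_sum]
    exact Finset.prod_congr rfl fun i _ => (Real.exp_nat_mul _ _).symm
  have hα (j : Fin q) : c j * ∏ i, Real.exp (y i) ^ α j i = lam j * Real.exp (-t) := by
    rw [hmon, eq_sub_of_add_eq (hy j), sub_eq_add_neg, Real.exp_add,
      Real.exp_log (div_pos (hlam j) (hc j)), ← mul_assoc, mul_div_cancel₀ _ (hc j).ne']
  have hβ : ∑ i, (β i : ℝ) * y i = ∑ j, Real.log (lam j / c j) * lam j - t := by
    calc ∑ i, (β i : ℝ) * y i = ∑ j, lam j * ∑ i, (α j i : ℝ) * y i := by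
          simp_rw [hbary, Finset.sum_mul, Finset.mul_sum, mul_assoc]
          exact Finset.sum_comm
      _ = ∑ j, (Real.log (lam j / c j) * lam j - lam j * t) :=
          Finset.sum_congr rfl fun j _ => by rw [← hy j]; ring
      _ = _ := by rw [Finset.sum_sub_distrib, ← Finset.sum_mul, hlamsum, one_mul]
  have hΘ : ∏ j, (c j / lam j) ^ lam j = Real.exp (-∑ j, Real.log (lam j / c j) * lam j) := by
    rw [← Finset.sum_neg_distrib, Real.exp_sum]
    refine Finset.prod_congr rfl fun j _ => ?_
    rw [Real.rpow_def_of_pos (div_pos (hc j) (hlam j)), ← inv_div, Real.log_inv, neg_mul]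
  simp_rw [hα]
  rw [← Finset.sum_mul, hlamsum, one_mul, hmon, hβ, hΘ, ← Real.exp_add]
  congr 1
  ring

/-- Some choice of signs makes `d` times the sign of the monomial `β` equal to `|d|`,
unless `β` is even and `d ≤ 0`. -/
theorem exists_sign_mul_prod_eq_abs {n : ℕ} (d : ℝ) (β : Fin n →₀ ℕ)
    (h : ¬((∀ i, Even (β i)) ∧ d ≤ 0)) :
    ∃ ε : Fin n → ℝ, (∀ i, ε i = 1 ∨ ε i = -1) ∧ d * ∏ i, ε i ^ β i = |d| := by
  rcases le_or_gt d 0 with hd | hd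
  · obtain ⟨k, hk⟩ : ∃ k, ¬Even (β k) := by
      by_contra! hcon
      exact h ⟨hcon, hd⟩
    refine ⟨fun i => if i = k then -1 else 1, fun i => by by_cases hi : i = k <;> simp [hi], ?_⟩
    rw [abs_of_nonpos hd]
    simp [ite_pow, (Nat.not_even_iff_odd.1 hk).neg_one_pow]
  · exact ⟨fun _ => 1, fun _ => Or.inl rfl, by simp [abs_of_pos hd]⟩

/-- **Nonnegativity of circuit polynomials via the circuit number**: a circuit polynomial
`f = Σ_{α∈T} c_α·x^α − d·x^β`, with trellis `T = {α₁,…,α_q}` (affinely independent even lattice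
points), `c_α > 0`, and `β` in the relative interior of `conv T` with barycentric coordinates
`λ₁,…,λ_q`, is nonnegative on `ℝⁿ` iff `f` is a sum of monomial squares or
`|d| ≤ Θ_f = Π_j (c_j/λ_j)^{λ_j}`. -/
theorem circuit_polynomial_nonneg_iff (n q : ℕ)
    (α : Fin q → (Fin n →₀ ℕ))
    (heven : ∀ (j : Fin q) (i : Fin n), 2 ∣ α j i)
    (haff : AffineIndependent ℝ (fun j : Fin q => (fun i : Fin n => (α j i : ℝ))))
    (c : Fin q → ℝ) (hc : ∀ j, 0 < c j)
    (d : ℝ) (β : Fin n →₀ ℕ)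
    (lam : Fin q → ℝ) (hlam : ∀ j, 0 < lam j) (hlamsum : ∑ j, lam j = 1)
    (hbary : ∀ i : Fin n, (β i : ℝ) = ∑ j, lam j * (α j i : ℝ))
    (f : MvPolynomial (Fin n) ℝ)
    (hf : f = (∑ j, monomial (α j) (c j)) - monomial β d) :
    (∀ x : Fin n → ℝ, 0 ≤ eval x f) ↔
      ((∃ (t : ℕ) (a : Fin t → ℝ) (γ : Fin t → (Fin n →₀ ℕ)),
          (∀ i, 0 ≤ a i) ∧ f = ∑ i, monomial (γ i + γ i) (a i)) ∨
        |d| ≤ ∏ j, (c j / lam j) ^ (lam j)) := by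
  have heval (x : Fin n → ℝ) :
      eval x f = ∑ j, c j * ∏ i, x i ^ α j i - d * ∏ i, x i ^ β i := by
    simp only [hf, map_sub, map_sum, eval_monomial_eq_prod]
  constructor
  · intro hnonneg
    by_cases h : (∀ i, Even (β i)) ∧ d ≤ 0
    · left
      choose γ hγ using fun j =>
        Finsupp.exists_add_self_of_even (α j) fun i => even_iff_two_dvd.2 (heven j i)
      obtain ⟨δ, hδ⟩ := Finsupp.exists_add_self_of_even β h.1
      refine ⟨q + 1, Fin.snoc c (-d), Fin.snoc γ δ, fun i => ?_, ?_⟩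
      · refine Fin.lastCases ?_ (fun j => ?_) i
        · simpa using h.2
        · simpa using (hc j).le
      · rw [Fin.sum_univ_castSucc]
        simp only [Fin.snoc_castSucc, Fin.snoc_last, ← hγ, ← hδ, hf, map_neg, sub_eq_add_neg]
    · right
      obtain ⟨ε, hε, hεd⟩ := exists_sign_mul_prod_eq_abs d β h
      obtain ⟨x, hx, hxeq⟩ := exists_pos_sum_eq_prod_rpow_mul haff hc hlam hlamsum hbary
      have hfx := hnonneg fun i => ε i * x i
      have hα (j : Fin q) : ∏ i, (ε i * x i) ^ α j i = ∏ i, x i ^ α j i := by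
        refine Finset.prod_congr rfl fun i _ => ?_
        rcases hε i with hi | hi <;> simp [hi, (even_iff_two_dvd.2 (heven j i)).neg_pow]
      rw [heval] at hfx
      simp_rw [hα, mul_pow] at hfx
      rw [hxeq, Finset.prod_mul_distrib, ← mul_assoc, hεd, sub_nonneg] at hfx
      exact le_of_mul_le_mul_right hfx (Finset.prod_pos fun i _ => pow_pos (hx i) _)
  · rintro (⟨t, a, γ, ha, hsum⟩ | hd) x
    · simp only [hsum, map_sum, eval_monomial_eq_prod]
      refine Finset.sum_nonneg fun i _ => mul_nonneg (ha i) (Finset.prod_nonneg fun k _ => ?_)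
      exact (Even.add_self (γ i k)).pow_nonneg (x k)
    · rw [heval, sub_nonneg]
      calc d * ∏ i, x i ^ β i ≤ |d| * |∏ i, x i ^ β i| := by
            rw [← abs_mul]
            exact le_abs_self _
        _ ≤ (∏ j, (c j / lam j) ^ lam j) * |∏ i, x i ^ β i| := by gcongr
        _ ≤ _ := prod_rpow_mul_abs_prod_pow_le_sum heven hc hlam hlamsum hbary x
end
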